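/- Let S be a set of n points in ℝ³, no three collinear and not all coplanar. Then the number of planes containing exactly three points of S satisfies m₃ ≥ n + (1/3)·Σ_{k≥4} k(k−4)·m_k; in particular, at least n planes contain exactly three points of S. -/

import Mathlib

open Set

noncomputable section

/-- Three-dimensional euclidean space. -/
abbrev Pt3 := EuclideanSpace ℝ (Fin 3)

/-- A plane in space: the affine span of three affinely independent points. -/
def IsPlane (P : Set Pt3) : Prop :=
  ∃ a b c : Pt3, AffineIndependent ℝ ![a, b, c] ∧
    P = (affineSpan ℝ ({a, b, c} : Set Pt3) : Set Pt3)

/-- `planeCount S k` is the number of planes containing exactly `k` points of `S`. -/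
def planeCount (S : Set Pt3) (k : ℕ) : ℕ :=
  {P : Set Pt3 | IsPlane P ∧ (S ∩ P).ncard = k}.ncard

/-- The planes determined by `S`: planes containing at least three points of `S`. -/
def detPlanes (S : Set Pt3) : Set (Set Pt3) :=
  {P : Set Pt3 | IsPlane P ∧ 3 ≤ (S ∩ P).ncard}

/-- No three points of `S` are collinear. -/
def NoThreeCollinear (S : Set Pt3) : Prop :=
  ∀ T ⊆ S, T.ncard = 3 → ¬ Collinear ℝ T

variable {ι : Type*}

/-- Slope and intercept of the line through the points of index `a` and `b`. -/
def lineThrough (x y : ι → ℝ) (a b : ι) : ℝ × ℝ :=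
  ((y b - y a) / (x b - x a), y a - (y b - y a) / (x b - x a) * x a)

/-- The lines through at least two of the points of a planar configuration. -/
def connectingLines [DecidableEq ι] (A : Finset ι) (x y : ι → ℝ) : Finset (ℝ × ℝ) :=
  A.offDiag.image fun ab => lineThrough x y ab.1 ab.2

/-- The points of a planar configuration on the line with given slope and intercept. -/
def pointsOn (A : Finset ι) (x y : ι → ℝ) (l : ℝ × ℝ) : Finset ι :=
  A.filter fun v => y v = l.1 * x v + l.2

/-- Signed vertical distance from the line `l`. -/
def height (x y : ι → ℝ) (l : ℝ × ℝ) (v : ι) : ℝ := y v - l.1 * x v - l.2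

theorem height_lineThrough {x y : ι → ℝ} {a b v : ι} (hab : x a ≠ x b) :
    height x y (lineThrough x y a b) v =
      ((x b - x a) * (y v - y a) - (y b - y a) * (x v - x a)) / (x b - x a) := by
  have : x b - x a ≠ 0 := sub_ne_zero.2 hab.symm
  simp only [height, lineThrough]
  field_simp
  ring

theorem mem_pointsOn {A : Finset ι} {x y : ι → ℝ} {l : ℝ × ℝ} {v : ι} :
    v ∈ pointsOn A x y l ↔ v ∈ A ∧ height x y l v = 0 := by
  simp only [pointsOn, height, Finset.mem_filter]
  constructor <;> rintro ⟨h, h'⟩ <;> exact ⟨h, by linarith⟩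

/-- Two points with distinct abscissae determine the line through them. -/
theorem line_eq_of_height_eq_zero {x y : ι → ℝ} {a b : ι} (hab : x a ≠ x b) {l l' : ℝ × ℝ}
    (ha : height x y l a = 0) (hb : height x y l b = 0)
    (ha' : height x y l' a = 0) (hb' : height x y l' b = 0) : l = l' := by
  simp only [height] at *
  have h1 : (l.1 - l'.1) * (x a - x b) = 0 := by linarith
  have h2 : l.1 = l'.1 := by
    rcases mul_eq_zero.1 h1 with h | h
    · linarith
    · exact absurd (sub_eq_zero.1 h) hab
  rw [h2] at ha
  exact Prod.ext h2 (by linarith)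

/-- For the line `l`, oriented by the sign `σ`, the point `p` is the first point on `l`. -/
structure IsFirstOn (A : Finset ι) (x y : ι → ℝ) (l : ℝ × ℝ) (σ : ℝ) (p : ι) : Prop where
  mem : p ∈ A
  height_eq : height x y l p = 0
  le : ∀ v ∈ A, height x y l v = 0 → σ * x p ≤ σ * x v

/-- Among the points strictly to the left of the oriented line `(l, σ)`, the point `q` is closest
to `l`, and it is the last such point in the direction of `l`. -/
structure IsNearest (A : Finset ι) (x y : ι → ℝ) (l : ℝ × ℝ) (σ : ℝ) (q : ι) : Prop where
  mem : q ∈ A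
  pos : 0 < σ * height x y l q
  le : ∀ v ∈ A, σ * height x y l v ≤ 0 ∨ σ * height x y l q < σ * height x y l v ∨
    (σ * height x y l q = σ * height x y l v ∧ σ * x v ≤ σ * x q)

section Uniqueness

variable {A : Finset ι} {x y : ι → ℝ} {l : ℝ × ℝ} {σ : ℝ}

theorem IsFirstOn.unique (hx : InjOn x A) (hσ : σ ≠ 0) {p p' : ι}
    (h : IsFirstOn A x y l σ p) (h' : IsFirstOn A x y l σ p') : p = p' :=
  hx h.mem h'.mem <| mul_left_cancel₀ hσ <|
    le_antisymm (h.le _ h'.mem h'.height_eq) (h'.le _ h.mem h.height_eq)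

theorem IsNearest.unique (hx : InjOn x A) (hσ : σ ≠ 0) {q q' : ι}
    (h : IsNearest A x y l σ q) (h' : IsNearest A x y l σ q') : q = q' := by
  refine hx h.mem h'.mem <| mul_left_cancel₀ hσ ?_
  have h1 := h.pos
  have h2 := h'.pos
  rcases h.le _ h'.mem with h3 | h3 | ⟨h3, h4⟩ <;> rcases h'.le _ h.mem with h5 | h5 | ⟨h5, h6⟩ <;>
    linarith

end Uniqueness

theorem lineThrough_mem_connectingLines [DecidableEq ι] {A : Finset ι} {x y : ι → ℝ} {a b : ι}
    (ha : a ∈ A) (hb : b ∈ A) (hab : a ≠ b) : lineThrough x y a b ∈ connectingLines A x y :=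
  Finset.mem_image.2 ⟨(a, b), Finset.mem_offDiag.2 ⟨ha, hb, hab⟩, rfl⟩

/-- If `X, Y` are the coordinates of the points with respect to the origin `p` and a positively
oriented basis whose first vector is `q - p`, and `u` is the first point met when a line rotates
around `p`, then `q` is the point nearest to the line through `p` and `u`. -/
theorem exists_line_of_rotation [DecidableEq ι] {A : Finset ι} {x y X Y : ι → ℝ} {d k s : ℝ}
    (hx : InjOn x A) (hd : d ≠ 0) {p q u : ι} (hp : p ∈ A) (hq : q ∈ A) (hu : u ∈ A)
    (hX : ∀ v, x v = x p + d * X v) (hY : ∀ v, y v = y p + k * X v + Y v / d)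
    (hqX : X q = 1) (hqY : Y q = 0) (huY : Y u < 0) (hus : X u + s * Y u = 0)
    (hpos : ∀ v ∈ A, 0 < Y v → 1 ≤ X v + s * Y v)
    (hneg : ∀ v ∈ A, Y v < 0 → X v + s * Y v ≤ 0)
    (hzero : ∀ v ∈ A, Y v = 0 → X v ≤ 0 ∨ v = q ∨ 1 < X v) :
    ∃ l ∈ connectingLines A x y, ∃ σ ∈ ({1, -1} : Finset ℝ),
      IsFirstOn A x y l σ p ∧ IsNearest A x y l σ q := by
  have hpX : X p = 0 := by
    have := hX p
    have : d * X p = 0 := by linarith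
    simpa [hd] using this
  have hpY : Y p = 0 := by
    have := hY p
    have : Y p / d = 0 := by rw [hpX] at this; linarith
    simpa [hd] using this
  have hpu : p ≠ u := by rintro rfl; linarith
  have hxpu : x p ≠ x u := fun h => hpu (hx hp hu h)
  have hXu : X u ≠ 0 := fun h => hxpu (by rw [hX u, h]; ring)
  have hs : s ≠ 0 := by rintro rfl; simp at hus; exact hXu hus
  have hsd : s * d ≠ 0 := mul_ne_zero hs hd
  have hh : ∀ v, height x y (lineThrough x y p u) v = (X v + s * Y v) / (s * d) := by
    intro v
    have hXs : X u = - s * Y u := by linarith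
    have : Y u ≠ 0 := huY.ne
    rw [height_lineThrough hxpu, hX v, hX u, hY v, hY u, hXs]
    field_simp
    ring
  obtain ⟨σ, hσ, c, hc, hσc⟩ : ∃ σ ∈ ({1, -1} : Finset ℝ), ∃ c > 0, σ / (s * d) = c := by
    rcases hsd.lt_or_gt with h | h
    · exact ⟨-1, by simp, _, div_pos_of_neg_of_neg (by norm_num) h, rfl⟩
    · exact ⟨1, by simp, _, by positivity, rfl⟩
  have hσh : ∀ v, σ * height x y (lineThrough x y p u) v = c * (X v + s * Y v) := by
    intro v; rw [hh, ← hσc]; ring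
  have hσ2 : σ * σ = 1 := by
    simp only [Finset.mem_insert, Finset.mem_singleton] at hσ
    rcases hσ with rfl | rfl <;> norm_num
  have hσd : σ * (s * d) > 0 := by
    have : σ * (s * d) = c * (s * d) ^ 2 := by rw [← hσc]; field_simp
    rw [this]; positivity
  refine ⟨_, lineThrough_mem_connectingLines hp hu hpu, σ, hσ, ⟨hp, ?_, ?_⟩, ⟨hq, ?_, ?_⟩⟩
  · rw [hh, hpX, hpY]; simp
  · intro v hv h0
    have h1 : X v = - s * Y v := by
      rw [hh, div_eq_zero_iff] at h0
      rcases h0 with h0 | h0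
      · linarith
      · exact absurd h0 hsd
    have h2 : Y v ≤ 0 := by
      by_contra! h
      have := hpos v hv h
      linarith
    rw [hX v, h1]
    nlinarith
  · rw [hσh, hqX, hqY]; simpa using hc
  · intro v hv
    rw [hσh, hσh, hqX, hqY]
    rcases lt_trichotomy (Y v) 0 with h | h | h
    · left; exact mul_nonpos_of_nonneg_of_nonpos hc.le (hneg v hv h)
    · rw [h]
      rcases hzero v hv h with h' | rfl | h'
      · left; nlinarith
      · right; right; simp [hqX]
      · right; left; nlinarith
    · right
      rcases (hpos v hv h).lt_or_eq with h' | h'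
      · left; nlinarith
      · right
        rw [← h']
        refine ⟨by ring, ?_⟩
        have h1 : X v = 1 - s * Y v := by linarith
        rw [hX v, hX q, h1, hqX]
        nlinarith

theorem exists_line_of_adjacent [DecidableEq ι] {A : Finset ι} {x y : ι → ℝ} (hx : InjOn x A)
    (hnc : ∀ l, ∃ v ∈ A, height x y l v ≠ 0) {w w' : ι} (hw : w ∈ A) (hw' : w' ∈ A)
    (hlt : x w < x w')
    (hadj : ∀ v ∈ A, height x y (lineThrough x y w w') v = 0 → x v ≤ x w ∨ x w' ≤ x v) :
    ∃ l ∈ connectingLines A x y, ∃ σ ∈ ({1, -1} : Finset ℝ),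
      (IsFirstOn A x y l σ w ∧ IsNearest A x y l σ w') ∨
        (IsFirstOn A x y l σ w' ∧ IsNearest A x y l σ w) := by
  have hd : 0 < x w' - x w := sub_pos.2 hlt
  set d := x w' - x w with hd_def
  have hdx : x w' = x w + d := by rw [hd_def]; ring
  set k := y w' - y w with hk_def
  have hky : y w' = y w + k := by rw [hk_def]; ring
  set X : ι → ℝ := fun v => (x v - x w) / d with hX_def
  set Y : ι → ℝ := fun v => d * (y v - y w - k * X v) with hY_def
  have hX : ∀ v, x v = x w + d * X v := by
    intro v; simp only [hX_def]; field_simp; ring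
  have hY : ∀ v, y v = y w + k * X v + Y v / d := by
    intro v; simp only [hY_def]; field_simp; ring
  have hYh : ∀ v, height x y (lineThrough x y w w') v = Y v / d := by
    intro v
    rw [height_lineThrough hlt.ne, ← hd_def, ← hk_def, hX v, hY v]
    field_simp
    ring
  have hw'X : X w' = 1 := by simp only [hX_def, ← hd_def]; exact div_self hd.ne'
  have hw'Y : Y w' = 0 := by simp only [hY_def, hw'X, ← hk_def]; ring
  have hzero : ∀ v ∈ A, Y v = 0 → X v ≤ 0 ∨ 1 ≤ X v := by
    intro v hv h0
    rcases hadj v hv (by rw [hYh, h0, zero_div]) with h | h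
    · left; rw [hX v] at h; nlinarith
    · right; rw [hX v, hdx] at h; nlinarith
  set B := A.filter fun v => Y v ≠ 0
  set t : ι → ℝ := fun v => if 0 < Y v then (1 - X v) / Y v else X v / (-Y v)
  have hB : B.Nonempty := by
    obtain ⟨v, hv, h⟩ := hnc (lineThrough x y w w')
    refine ⟨v, Finset.mem_filter.2 ⟨hv, fun h0 => h ?_⟩⟩
    rw [hYh, h0, zero_div]
  obtain ⟨u, huB, hu⟩ := Finset.exists_max_image B t hB
  obtain ⟨huA, huY⟩ := Finset.mem_filter.1 huB
  have hpos : ∀ v ∈ A, 0 < Y v → 1 ≤ X v + t u * Y v := by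
    intro v hv h
    have := hu v (Finset.mem_filter.2 ⟨hv, h.ne'⟩)
    rw [show t v = (1 - X v) / Y v from if_pos h, div_le_iff₀ h] at this
    linarith
  have hneg : ∀ v ∈ A, Y v < 0 → X v + t u * Y v ≤ 0 := by
    intro v hv h
    have := hu v (Finset.mem_filter.2 ⟨hv, h.ne⟩)
    rw [show t v = X v / (-Y v) from if_neg h.not_gt, div_le_iff₀ (neg_pos.2 h)] at this
    linarith
  rcases huY.lt_or_gt with h | h
  · obtain ⟨l, hl, σ, hσ, hQ⟩ := exists_line_of_rotation hx hd.ne' hw hw' huA hX hY hw'X hw'Y h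
      (by rw [show t u = X u / (-Y u) from if_neg h.not_gt]; field_simp; ring) hpos hneg
      (fun v hv h0 => by
        rcases hzero v hv h0 with h1 | h1
        · exact .inl h1
        · rcases h1.lt_or_eq with h1 | h1
          · exact .inr (.inr h1)
          · exact .inr (.inl (hx hv hw' (by rw [hX v, hX w', hw'X, ← h1]))))
    exact ⟨l, hl, σ, hσ, .inl hQ⟩
  · obtain ⟨l, hl, σ, hσ, hQ⟩ := exists_line_of_rotation (y := y) (X := fun v => 1 - X v)
      (Y := fun v => - Y v) (d := -d) (k := -k) (s := t u) hx (neg_ne_zero.2 hd.ne') hw' hw huA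
      (fun v => by rw [hX v, hdx]; ring) (fun v => by rw [hY v, hky]; field_simp; ring)
      (by simp [hX_def]) (by simp [hY_def, hX_def]) (neg_neg_iff_pos.2 h)
      (by rw [show t u = (1 - X u) / Y u from if_pos h]; field_simp; ring)
      (fun v hv h0 => by have := hneg v hv (by linarith); linarith)
      (fun v hv h0 => by have := hpos v hv (by linarith); linarith)
      (fun v hv h0 => by
        rcases hzero v hv (by linarith) with h1 | h1
        · rcases h1.lt_or_eq with h1 | h1
          · exact .inr (.inr (by linarith))
          · exact .inr (.inl (hx hv hw (by rw [hX v, h1]; ring)))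
        · exact .inl (by linarith))
    exact ⟨l, hl, σ, hσ, .inr hQ⟩

/-- An exposed point of a planar configuration is the first point of a supporting line. -/
theorem exists_supporting_line [DecidableEq ι] {A : Finset ι} {x y : ι → ℝ} (hx : InjOn x A)
    {p : ι} (hp : p ∈ A) (hA : (A.erase p).Nonempty) {α β : ℝ}
    (hαβ : ∀ v ∈ A, v ≠ p → α * x v + β * y v < α * x p + β * y p) :
    ∃ l ∈ connectingLines A x y, ∃ σ ∈ ({1, -1} : Finset ℝ),
      IsFirstOn A x y l σ p ∧ ∀ v ∈ A, σ * height x y l v ≤ 0 := by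
  set H : ι → ℝ := fun v => α * (x p - x v) + β * (y p - y v) with hH
  set T : ι → ℝ := fun v => α * (y v - y p) - β * (x v - x p) with hT
  have hHpos : ∀ v ∈ A, v ≠ p → 0 < H v := by
    intro v hv hvp
    have := hαβ v hv hvp
    simp only [hH]; linarith
  obtain ⟨u, hu, hmin⟩ := Finset.exists_min_image (A.erase p) (fun v => T v / H v) hA
  obtain ⟨hup, huA⟩ := Finset.mem_erase.1 hu
  have hHu := hHpos u huA hup
  have hxpu : x p ≠ x u := fun h => hup (hx hp huA h).symm
  have hxpu' : x u - x p ≠ 0 := sub_ne_zero.2 hxpu.symm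
  set D : ι → ℝ := fun v => (x u - x p) * (y v - y p) - (y u - y p) * (x v - x p) with hD
  have hDle : ∀ v ∈ A, D v ≤ 0 := by
    intro v hv
    by_cases hvp : v = p
    · subst hvp; simp [hD]
    have h1 := hmin v (Finset.mem_erase.2 ⟨hvp, hv⟩)
    rw [div_le_div_iff₀ hHu (hHpos v hv hvp)] at h1
    have h2 : H u * T v - T u * H v = -(α ^ 2 + β ^ 2) * D v := by
      simp only [hH, hT, hD]; ring
    have h3 : 0 < α ^ 2 + β ^ 2 := by
      by_contra! h
      have ha : α = 0 := by nlinarith [sq_nonneg α, sq_nonneg β]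
      have hb : β = 0 := by nlinarith [sq_nonneg α, sq_nonneg β]
      simp [hH, ha, hb] at hHu
    by_contra! h
    nlinarith
  obtain ⟨σ, hσ, c, hc, hσc⟩ : ∃ σ ∈ ({1, -1} : Finset ℝ), ∃ c > 0, σ / (x u - x p) = c := by
    rcases hxpu'.lt_or_gt with h | h
    · exact ⟨-1, by simp, _, div_pos_of_neg_of_neg (by norm_num) h, rfl⟩
    · exact ⟨1, by simp, _, by positivity, rfl⟩
  have hσu : 0 < σ * (x u - x p) := by
    have : σ * (x u - x p) = c * (x u - x p) ^ 2 := by rw [← hσc]; field_simp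
    rw [this]; positivity
  refine ⟨_, lineThrough_mem_connectingLines hp huA hup.symm, σ, hσ, ⟨hp, ?_, ?_⟩, ?_⟩
  · rw [height_lineThrough hxpu]; simp
  · intro v hv h0
    by_cases hvp : v = p
    · rw [hvp]
    rw [height_lineThrough hxpu, div_eq_zero_iff] at h0
    have hD0 : D v = 0 := h0.resolve_right hxpu'
    have h1 : H u * (x v - x p) = H v * (x u - x p) + β * D v := by
      simp only [hH, hD]; ring
    have h2 := hHpos v hv hvp
    have h3 : H u * (σ * (x v - x p)) = H v * (σ * (x u - x p)) := by
      rw [hD0] at h1; linear_combination σ * h1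
    have h4 : 0 < σ * (x v - x p) :=
      pos_of_mul_pos_right (h3 ▸ mul_pos h2 hσu) hHu.le
    linarith
  · intro v hv
    rw [height_lineThrough hxpu]
    have : σ * (D v / (x u - x p)) = c * D v := by rw [← hσc]; ring
    exact this ▸ mul_nonpos_of_nonneg_of_nonpos hc.le (hDle v hv)

/-- A planar configuration that is not collinear has at least three exposed points. -/
theorem exists_three_exposed [DecidableEq ι] {A : Finset ι} {x y : ι → ℝ}
    (hx : InjOn x A) (hnc : ∀ l, ∃ v ∈ A, height x y l v ≠ 0) :
    ∃ P ⊆ A, 3 ≤ P.card ∧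
      ∀ p ∈ P, ∃ α β : ℝ, ∀ v ∈ A, v ≠ p → α * x v + β * y v < α * x p + β * y p := by
  set f : ι → ℝ × ℝ := fun v => (x v, y v) with hf
  have hfin : (f '' A).Finite := A.finite_toSet.image f
  set K := convexHull ℝ (f '' A)
  have hKc : IsCompact K := hfin.isCompact_convexHull ℝ
  have hext : K.extremePoints ℝ ⊆ f '' A := extremePoints_convexHull_subset
  classical
  set P := A.filter fun v => f v ∈ K.extremePoints ℝ with hP
  have himage : K.extremePoints ℝ = f '' P := by
    ext z
    constructor
    · intro hz
      obtain ⟨v, hv, rfl⟩ := hext hz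
      exact ⟨v, by simpa [hP] using ⟨hv, hz⟩, rfl⟩
    · rintro ⟨v, hv, rfl⟩
      exact (Finset.mem_filter.1 hv).2
  refine ⟨P, Finset.filter_subset _ _, ?_, ?_⟩
  · by_contra! hlt
    obtain ⟨l, hl⟩ : ∃ l : ℝ × ℝ, ∀ v ∈ P, height x y l v = 0 := by
      rcases P.eq_empty_or_nonempty with h | ⟨a, ha⟩
      · exact ⟨0, by simp [h]⟩
      by_cases h : ∃ b ∈ P, b ≠ a
      · obtain ⟨b, hb, hba⟩ := h
        have hab : x a ≠ x b := fun h =>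
          hba (hx (Finset.mem_filter.1 ha).1 (Finset.mem_filter.1 hb).1 h).symm
        have hsub : ({a, b} : Finset ι) ⊆ P := by
          simp [Finset.insert_subset_iff, ha, hb]
        have heq : ({a, b} : Finset ι) = P :=
          Finset.eq_of_subset_of_card_le hsub (by rw [Finset.card_pair hba.symm]; omega)
        refine ⟨lineThrough x y a b, fun v hv => ?_⟩
        rw [← heq] at hv
        rw [height_lineThrough hab]
        rcases Finset.mem_insert.1 hv with rfl | hv
        · simp
        · rw [Finset.mem_singleton.1 hv]; ring
      · push Not at h
        exact ⟨(0, y a), fun v hv => by rw [h v hv]; simp [height]⟩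
    have hconv : Convex ℝ {z : ℝ × ℝ | z.2 - l.1 * z.1 = l.2} := by
      intro z hz w hw a b _ _ hab
      simp only [mem_ofPred_eq, Prod.snd_add, Prod.smul_snd, Prod.fst_add, Prod.smul_fst,
        smul_eq_mul] at *
      linear_combination a * hz + b * hw + l.2 * hab
    have hclosed : IsClosed {z : ℝ × ℝ | z.2 - l.1 * z.1 = l.2} :=
      isClosed_eq (by fun_prop) continuous_const
    have hKsub : K ⊆ {z : ℝ × ℝ | z.2 - l.1 * z.1 = l.2} := by
      rw [← closure_convexHull_extremePoints hKc (convex_convexHull ℝ _)]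
      refine closure_minimal (convexHull_min ?_ hconv) hclosed
      rw [himage]
      rintro _ ⟨v, hv, rfl⟩
      have := hl v hv
      simp only [height] at this
      simp only [hf, mem_ofPred_eq]
      linarith
    obtain ⟨v, hv, h⟩ := hnc l
    have h1 : f v ∈ K := subset_convexHull ℝ _ ⟨v, hv, rfl⟩
    have h2 := hKsub h1
    simp only [hf, mem_ofPred_eq] at h2
    exact h (by simp only [height]; linarith)
  · intro p hp
    obtain ⟨hpA, hpe⟩ := Finset.mem_filter.1 hp
    have hnot : f p ∉ convexHull ℝ (f '' (A.erase p : Finset ι)) := by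
      intro hmem
      have h1 := ((convex_convexHull ℝ (f '' A)).mem_extremePoints_iff_mem_sdiff_convexHull_sdiff.1
        hpe).2
      refine h1 (convexHull_mono ?_ hmem)
      rintro _ ⟨v, hv, rfl⟩
      obtain ⟨hvp, hvA⟩ := Finset.mem_erase.1 hv
      refine ⟨subset_convexHull ℝ _ ⟨v, hvA, rfl⟩, fun h => hvp (hx hvA hpA ?_)⟩
      exact congrArg Prod.fst h
    obtain ⟨g, c, hg, hc⟩ := geometric_hahn_banach_closed_point (convex_convexHull ℝ _)
      (((A.erase p).finite_toSet.image f).isCompact_convexHull ℝ).isClosed hnot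
    have hgf : ∀ v, g (f v) = g (1, 0) * x v + g (0, 1) * y v := by
      intro v
      have : f v = x v • ((1 : ℝ), (0 : ℝ)) + y v • ((0 : ℝ), (1 : ℝ)) := by
        simp [hf]
      rw [this, map_add, map_smul, map_smul, smul_eq_mul, smul_eq_mul]
      ring
    refine ⟨g (1, 0), g (0, 1), fun v hv hvp => ?_⟩
    rw [← hgf, ← hgf]
    exact (hg _ (subset_convexHull ℝ _ ⟨v, by simp [hv, hvp], rfl⟩)).trans hc

/-- The pairs of points that are consecutive, from left to right, on the line joining them. -/
def adjacentPairs (A : Finset ι) (x y : ι → ℝ) : Finset (ι × ι) :=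
  (A ×ˢ A).filter fun w => x w.1 < x w.2 ∧
    ∀ v ∈ A, height x y (lineThrough x y w.1 w.2) v = 0 → x v ≤ x w.1 ∨ x w.2 ≤ x v

theorem sum_card_pointsOn_sub_one_le [DecidableEq ι] {A : Finset ι} {x y : ι → ℝ}
    (hx : InjOn x A) :
    ∑ l ∈ connectingLines A x y, ((pointsOn A x y l).card - 1) ≤ (adjacentPairs A x y).card := by
  refine (Finset.sum_le_sum fun l _ => ?_).trans ((Finset.sum_card_fiberwise_eq_card_filter
    (adjacentPairs A x y) (connectingLines A x y) fun w => lineThrough x y w.1 w.2).trans_le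
      (Finset.card_filter_le _ _))
  rcases (pointsOn A x y l).eq_empty_or_nonempty with h | h
  · simp [h]
  obtain ⟨z, hz, hmax⟩ := Finset.exists_max_image _ x h
  rw [← Finset.card_erase_of_mem hz]
  refine Finset.card_le_card_of_surjOn Prod.fst fun w hw => ?_
  obtain ⟨hwz, hwl⟩ := Finset.mem_erase.1 hw
  have hwA := (mem_pointsOn.1 hwl).1
  have hlt : x w < x z := (hmax w hwl).lt_of_ne fun h => hwz (hx hwA (mem_pointsOn.1 hz).1 h)
  obtain ⟨w', hw', hmin⟩ := Finset.exists_min_image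
    ((pointsOn A x y l).filter fun v => x w < x v) x ⟨z, by simp [hz, hlt]⟩
  obtain ⟨hw'l, hww'⟩ := Finset.mem_filter.1 hw'
  have hw'A := (mem_pointsOn.1 hw'l).1
  have hline : lineThrough x y w w' = l := by
    refine line_eq_of_height_eq_zero hww'.ne ?_ ?_ (mem_pointsOn.1 hwl).2 (mem_pointsOn.1 hw'l).2
    · rw [height_lineThrough hww'.ne]; simp
    · rw [height_lineThrough hww'.ne]; ring
  refine ⟨(w, w'), ?_, rfl⟩
  simp only [adjacentPairs, Finset.coe_filter, Finset.mem_filter, Finset.mem_product,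
    mem_ofPred_eq]
  refine ⟨⟨⟨hwA, hw'A⟩, hww', fun v hv h0 => ?_⟩, hline⟩
  rw [hline] at h0
  by_contra! hv'
  exact (hmin v (Finset.mem_filter.2 ⟨mem_pointsOn.2 ⟨hv, h0⟩, hv'.1⟩)).not_gt hv'.2

/-- **Melchior's inequality**. -/
theorem melchior [DecidableEq ι] {A : Finset ι} {x y : ι → ℝ} (hx : InjOn x A)
    (hnc : ∀ l, ∃ v ∈ A, height x y l v ≠ 0) :
    ∑ l ∈ connectingLines A x y, ((pointsOn A x y l).card - 1) + 3 ≤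
      2 * (connectingLines A x y).card := by
  obtain ⟨P, hPA, hP3, hP⟩ := exists_three_exposed hx hnc
  set L := connectingLines A x y with hL
  have hpair : ∀ w ∈ adjacentPairs A x y, ∃ t ∈ L ×ˢ ({1, -1} : Finset ℝ),
      (IsFirstOn A x y t.1 t.2 w.1 ∧ IsNearest A x y t.1 t.2 w.2) ∨
        (IsFirstOn A x y t.1 t.2 w.2 ∧ IsNearest A x y t.1 t.2 w.1) := by
    intro w hw
    simp only [adjacentPairs, Finset.mem_filter, Finset.mem_product] at hw
    obtain ⟨l, hl, σ, hσ, h⟩ := exists_line_of_adjacent hx hnc hw.1.1 hw.1.2 hw.2.1 hw.2.2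
    exact ⟨(l, σ), Finset.mem_product.2 ⟨hl, hσ⟩, h⟩
  have hsupp : ∀ p ∈ P, ∃ t ∈ L ×ˢ ({1, -1} : Finset ℝ),
      IsFirstOn A x y t.1 t.2 p ∧ ∀ v ∈ A, t.2 * height x y t.1 v ≤ 0 := by
    intro p hp
    obtain ⟨α, β, h⟩ := hP p hp
    have hne : (A.erase p).Nonempty := by
      rw [← Finset.card_pos, Finset.card_erase_of_mem (hPA hp)]
      have := Finset.card_le_card hPA
      omega
    obtain ⟨l, hl, σ, hσ, h⟩ := exists_supporting_line hx (hPA hp) hne h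
    exact ⟨(l, σ), Finset.mem_product.2 ⟨hl, hσ⟩, h⟩
  choose! g hg hgw using hpair
  choose! e he hep using hsupp
  have hσ0 : ∀ t ∈ L ×ˢ ({1, -1} : Finset ℝ), t.2 ≠ 0 := by
    intro t ht
    have := (Finset.mem_product.1 ht).2
    simp only [Finset.mem_insert, Finset.mem_singleton] at this
    rcases this with h | h <;> rw [h] <;> norm_num
  have hginj : InjOn g (adjacentPairs A x y) := by
    intro w hw w' hw' hww'
    have h0 := hσ0 _ (hg w hw)
    have h1 := hgw w hw
    have h2 := hgw w' hw'
    rw [← hww'] at h2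
    have hlt : x w.1 < x w.2 := (Finset.mem_filter.1 hw).2.1
    have hlt' : x w'.1 < x w'.2 := (Finset.mem_filter.1 hw').2.1
    rcases h1 with ⟨h1, h3⟩ | ⟨h1, h3⟩ <;> rcases h2 with ⟨h2, h4⟩ | ⟨h2, h4⟩
    · exact Prod.ext (h1.unique hx h0 h2) (h3.unique hx h0 h4)
    · rw [h1.unique hx h0 h2, h3.unique hx h0 h4] at hlt
      exact absurd hlt hlt'.not_gt
    · rw [h1.unique hx h0 h2, h3.unique hx h0 h4] at hlt
      exact absurd hlt hlt'.not_gt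
    · exact Prod.ext (h3.unique hx h0 h4) (h1.unique hx h0 h2)
  have heinj : InjOn e P := by
    intro p hp p' hp' hpp'
    have h2 := (hep p' hp').1
    rw [← hpp'] at h2
    exact (hep p hp).1.unique hx (hσ0 _ (he p hp)) h2
  have hdisj : Disjoint ((adjacentPairs A x y).image g) (P.image e) := by
    rw [Finset.disjoint_left]
    intro t ht ht'
    obtain ⟨w, hw, rfl⟩ := Finset.mem_image.1 ht
    obtain ⟨p, hp, hpe⟩ := Finset.mem_image.1 ht'
    have h := (hep p hp).2
    rw [hpe] at h
    rcases hgw w hw with ⟨-, h'⟩ | ⟨-, h'⟩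
    · exact (h _ h'.mem).not_gt h'.pos
    · exact (h _ h'.mem).not_gt h'.pos
  have hsub : (adjacentPairs A x y).image g ∪ P.image e ⊆ L ×ˢ ({1, -1} : Finset ℝ) :=
    Finset.union_subset (Finset.image_subset_iff.2 hg) (Finset.image_subset_iff.2 he)
  have hcard := Finset.card_le_card hsub
  rw [Finset.card_union_of_disjoint hdisj, Finset.card_image_of_injOn hginj,
    Finset.card_image_of_injOn heinj, Finset.card_product,
    Finset.card_pair (by norm_num : (1 : ℝ) ≠ -1)] at hcard
  have := sum_card_pointsOn_sub_one_le (y := y) hx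
  rw [← hL] at this
  omega

/-- Finitely many nonzero real polynomials have a common point at which none of them vanishes. -/
theorem exists_forall_eval_ne_zero {κ : Type*} (s : Finset κ) (f : κ → Polynomial ℝ)
    (hf : ∀ i ∈ s, f i ≠ 0) : ∃ t : ℝ, ∀ i ∈ s, (f i).eval t ≠ 0 := by
  have h : ∏ i ∈ s, f i ≠ 0 := Finset.prod_ne_zero_iff.2 hf
  obtain ⟨t, ht⟩ : ∃ t : ℝ, (∏ i ∈ s, f i).eval t ≠ 0 := by
    by_contra! h0
    exact h (Polynomial.funext fun t => by simp [h0 t])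
  rw [Polynomial.eval_prod, Finset.prod_ne_zero_iff] at ht
  exact ⟨t, ht⟩

/-- The determinant of three vectors in space. -/
def det₃ (u v w : Pt3) : ℝ :=
  u 0 * (v 1 * w 2 - v 2 * w 1) - u 1 * (v 0 * w 2 - v 2 * w 0) + u 2 * (v 0 * w 1 - v 1 * w 0)

theorem collinear_of_sub_eq_smul {p a b : Pt3} {r : ℝ} (h : b - p = r • (a - p)) :
    Collinear ℝ {p, a, b} := by
  rw [collinear_iff_of_mem (p₀ := p) (by simp)]
  refine ⟨a - p, ?_⟩
  rintro c (rfl | rfl | rfl)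
  · exact ⟨0, by simp⟩
  · exact ⟨1, by simp⟩
  · exact ⟨r, by rw [← h]; simp⟩

theorem collinear_of_minors_eq_zero {p a b : Pt3}
    (h : ∀ i j, (a - p) i * (b - p) j = (a - p) j * (b - p) i) : Collinear ℝ {p, a, b} := by
  by_cases ha : a - p = 0
  · rw [sub_eq_zero.1 ha, Set.insert_eq_of_mem (by simp)]
    exact collinear_pair ℝ p b
  obtain ⟨i, hi⟩ : ∃ i, (a - p) i ≠ 0 := by
    by_contra! h0
    exact ha (PiLp.ext h0)
  refine collinear_of_sub_eq_smul (r := (b - p) i / (a - p) i) (PiLp.ext fun j => ?_)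
  rw [PiLp.smul_apply, smul_eq_mul, div_mul_eq_mul_div, eq_div_iff hi]
  linarith [h i j]

theorem mem_affineSpan_triple_iff {p a b c : Pt3} :
    c ∈ affineSpan ℝ ({p, a, b} : Set Pt3) ↔ ∃ s t : ℝ, s • (a - p) + t • (b - p) = c - p := by
  have hp : p ∈ affineSpan ℝ ({p, a, b} : Set Pt3) := subset_affineSpan ℝ _ (by simp)
  rw [← AffineSubspace.vsub_right_mem_direction_iff_mem hp, direction_affineSpan,
    vectorSpan_eq_span_vsub_set_right ℝ (p := p) (by simp)]
  simp only [Set.image_insert_eq, Set.image_singleton, vsub_eq_sub, sub_self,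
    Submodule.span_insert_zero, Submodule.mem_span_pair]

theorem mem_affineSpan_iff_det₃_eq_zero {p a b c : Pt3} (h : ¬ Collinear ℝ {p, a, b}) :
    c ∈ affineSpan ℝ ({p, a, b} : Set Pt3) ↔ det₃ (a - p) (b - p) (c - p) = 0 := by
  rw [mem_affineSpan_triple_iff]
  constructor
  · rintro ⟨s, t, h⟩
    rw [← h]
    simp only [det₃, PiLp.add_apply, PiLp.smul_apply, smul_eq_mul]
    ring
  · intro hdet
    obtain ⟨i, j, hij⟩ : ∃ i j, (a - p) i * (b - p) j ≠ (a - p) j * (b - p) i := by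
      by_contra! h0
      exact h (collinear_of_minors_eq_zero h0)
    generalize a - p = u at *
    generalize b - p = v at *
    generalize c - p = w at *
    refine ⟨(w i * v j - w j * v i) / (u i * v j - u j * v i),
      (u i * w j - u j * w i) / (u i * v j - u j * v i), PiLp.ext fun k => ?_⟩
    rw [PiLp.add_apply, PiLp.smul_apply, PiLp.smul_apply, smul_eq_mul, smul_eq_mul,
      div_mul_eq_mul_div, div_mul_eq_mul_div, ← add_div, div_eq_iff (sub_ne_zero.2 hij)]
    simp only [det₃] at hdet
    clear hij
    fin_cases i <;> fin_cases j <;> fin_cases k <;> dsimp only [Fin.isValue, Fin.zero_eta,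
      Fin.mk_one, Fin.reduceFinMk] <;> linarith

/-- Central projection from `p` to a plane that is generic with respect to the finite set `A`. -/
theorem exists_projection {A : Finset Pt3} {p : Pt3} (hp : p ∉ A)
    (hcol : ∀ a ∈ A, ∀ b ∈ A, a ≠ b → ¬ Collinear ℝ {p, a, b}) :
    ∃ x y : Pt3 → ℝ, InjOn x A ∧ ∀ a ∈ A, ∀ b ∈ A, a ≠ b → ∀ c ∈ A,
      (height x y (lineThrough x y a b) c = 0 ↔ c ∈ affineSpan ℝ ({p, a, b} : Set Pt3)) := by
  open Polynomial in
  obtain ⟨t, ht⟩ := exists_forall_eval_ne_zero A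
    (fun a => C ((a - p) 0) + C ((a - p) 1) * X + C ((a - p) 2) * X ^ 2) (by
      intro a ha h0
      have h (i : ℕ) := congrArg (fun q : ℝ[X] => q.coeff i) h0
      have h00 := h 0
      have h01 := h 1
      have h02 := h 2
      simp [coeff_X, coeff_C, coeff_X_pow, -map_sub] at h00 h01 h02
      refine hp ?_
      convert ha
      refine PiLp.ext fun i => ?_
      fin_cases i <;> simp <;> linarith)
  set φ : Pt3 → ℝ := fun a => (a - p) 0 + (a - p) 1 * t + (a - p) 2 * t ^ 2 with hφ
  have hφ0 : ∀ a ∈ A, φ a ≠ 0 := by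
    intro a ha
    simpa [hφ] using ht a ha
  set y : Pt3 → ℝ := fun a => (a - p) 2 / φ a with hy
  set z : Pt3 → ℝ := fun a => (a - p) 1 / φ a with hz
  have hinj : ∀ a ∈ A, ∀ b ∈ A, a ≠ b → z a - z b ≠ 0 ∨ y a - y b ≠ 0 := by
    intro a ha b hb hab
    by_contra! h
    have ha0 := hφ0 a ha
    have hb0 := hφ0 b hb
    simp only [hz, hy, sub_eq_zero, div_eq_div_iff ha0 hb0] at h
    obtain ⟨h1, h2⟩ := h
    refine hcol a ha b hb hab (collinear_of_sub_eq_smul (r := φ b / φ a) (PiLp.ext fun i => ?_))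
    rw [PiLp.smul_apply, smul_eq_mul, div_mul_eq_mul_div, eq_div_iff ha0]
    have h0 : (b - p) 0 * φ a = φ b * (a - p) 0 := by
      simp only [hφ] at h1 h2 ⊢
      linear_combination t * h1 + t ^ 2 * h2
    fin_cases i
    · exact h0
    · exact h1.symm.trans (mul_comm _ _)
    · exact h2.symm.trans (mul_comm _ _)
  open Polynomial in
  obtain ⟨s, hs⟩ := exists_forall_eval_ne_zero A.offDiag
    (fun ab => C (z ab.1 - z ab.2) + C (y ab.1 - y ab.2) * X) (by
      rintro ⟨a, b⟩ hab h0
      obtain ⟨ha, hb, hab⟩ := Finset.mem_offDiag.1 hab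
      have h (i : ℕ) := congrArg (fun q : ℝ[X] => q.coeff i) h0
      have h00 := h 0
      have h01 := h 1
      simp [coeff_X, coeff_C, -map_sub] at h00 h01
      exact (hinj a ha b hb hab).elim (· h00) (· h01))
  have hx : InjOn (fun a => z a + s * y a) A := by
    intro a ha b hb h
    by_contra hab
    refine hs (a, b) (Finset.mem_offDiag.2 ⟨ha, hb, hab⟩) ?_
    simp only [Polynomial.eval_add, Polynomial.eval_mul, Polynomial.eval_C, Polynomial.eval_X]
    simp only at h
    linarith
  refine ⟨fun a => z a + s * y a, y, hx, fun a ha b hb hab c hc => ?_⟩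
  have hxab : z a + s * y a ≠ z b + s * y b := fun h => hab (hx ha hb h)
  rw [height_lineThrough hxab, div_eq_zero_iff, or_iff_left (sub_ne_zero.2 hxab.symm),
    mem_affineSpan_iff_det₃_eq_zero (hcol a ha b hb hab)]
  have ha0 := hφ0 a ha
  have hb0 := hφ0 b hb
  have hc0 := hφ0 c hc
  have key : (z b + s * y b - (z a + s * y a)) * (y c - y a) -
      (y b - y a) * (z c + s * y c - (z a + s * y a)) =
        det₃ (a - p) (b - p) (c - p) / (φ a * φ b * φ c) := by
    simp only [hz, hy, det₃]
    field_simp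
    simp only [hφ]
    ring
  rw [key, div_eq_zero_iff, or_iff_left (by positivity)]

theorem isPlane_affineSpan {p a b : Pt3} (h : ¬ Collinear ℝ {p, a, b}) :
    IsPlane (affineSpan ℝ ({p, a, b} : Set Pt3)) :=
  ⟨p, a, b, affineIndependent_iff_not_collinear_set.2 h, rfl⟩

/-- A plane is spanned by any three of its points that are not collinear. -/
theorem IsPlane.eq_affineSpan {P : Set Pt3} (hP : IsPlane P) {p a b : Pt3} (hp : p ∈ P)
    (ha : a ∈ P) (hb : b ∈ P) (h : ¬ Collinear ℝ {p, a, b}) :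
    P = affineSpan ℝ ({p, a, b} : Set Pt3) := by
  obtain ⟨a', b', c', hi, rfl⟩ := hP
  have hrange : ∀ u v w : Pt3, Set.range ![u, v, w] = {u, v, w} := by
    intro u v w
    rw [Matrix.range_cons, Matrix.range_cons_cons_empty, Set.singleton_union]
  have hj : AffineIndependent ℝ ![p, a, b] := affineIndependent_iff_not_collinear_set.2 h
  have hle : affineSpan ℝ (Set.range ![p, a, b]) ≤ affineSpan ℝ ({a', b', c'} : Set Pt3) := by
    rw [affineSpan_le, hrange]
    rintro v (rfl | rfl | rfl) <;> assumption
  have hdim : Module.finrank ℝ (affineSpan ℝ ({a', b', c'} : Set Pt3)).direction = 2 := by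
    rw [direction_affineSpan, ← hrange]
    exact hi.finrank_vectorSpan (by simp)
  have hfd : FiniteDimensional ℝ (affineSpan ℝ ({a', b', c'} : Set Pt3)).direction := inferInstance
  have := hj.affineSpan_eq_of_le_of_card_eq_finrank_add_one hle (by rw [hdim]; simp)
  rw [← this, hrange]

theorem NoThreeCollinear.not_collinear {S : Set Pt3} (h3 : NoThreeCollinear S) {p a b : Pt3}
    (hp : p ∈ S) (ha : a ∈ S) (hb : b ∈ S) (hpa : p ≠ a) (hpb : p ≠ b) (hab : a ≠ b) :
    ¬ Collinear ℝ {p, a, b} := by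
  refine h3 {p, a, b} ?_ (Set.ncard_eq_three.2 ⟨p, a, b, hpa, hpb, hab, rfl⟩)
  rintro v (rfl | rfl | rfl) <;> assumption

/-- The sets of at least three points cut out from `S` by a plane. -/
def planeSections (S : Finset Pt3) : Finset (Finset Pt3) := by
  classical
  exact S.powerset.filter fun B => 3 ≤ B.card ∧ ∃ P, IsPlane P ∧ (B : Set Pt3) = ↑S ∩ P

theorem mem_planeSections {S B : Finset Pt3} :
    B ∈ planeSections S ↔ 3 ≤ B.card ∧ ∃ P, IsPlane P ∧ (B : Set Pt3) = ↑S ∩ P := by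
  classical
  simp only [planeSections, Finset.mem_filter, Finset.mem_powerset, and_iff_right_iff_imp]
  rintro ⟨-, P, -, h⟩
  exact Finset.coe_subset.1 (h ▸ Set.inter_subset_left)

theorem planeCount_eq_card {S : Finset Pt3} (h3 : NoThreeCollinear S) {k : ℕ} (hk : 3 ≤ k) :
    planeCount S k = ((planeSections S).filter fun B => B.card = k).card := by
  classical
  have hinj : InjOn (fun P : Set Pt3 => (S : Set Pt3) ∩ P)
      {P : Set Pt3 | IsPlane P ∧ ((S : Set Pt3) ∩ P).ncard = k} := by
    rintro P ⟨hP, hPk⟩ P' ⟨hP', -⟩ h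
    replace h : (S : Set Pt3) ∩ P = ↑S ∩ P' := h
    obtain ⟨p, a, b, hp, ha, hb, hpa, hpb, hab⟩ :=
      (Set.two_lt_ncard_iff (S.finite_toSet.inter_of_left P)).1 (by omega)
    have hcol := h3.not_collinear hp.1 ha.1 hb.1 hpa hpb hab
    rw [hP.eq_affineSpan hp.2 ha.2 hb.2 hcol]
    rw [h] at hp ha hb
    rw [hP'.eq_affineSpan hp.2 ha.2 hb.2 hcol]
  rw [planeCount, ← hinj.ncard_image, ← Set.ncard_coe_finset,
    ← Set.ncard_image_of_injective _ Finset.coe_injective]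
  congr 1
  ext T
  constructor
  · rintro ⟨P, ⟨hP, hPk⟩, rfl⟩
    refine ⟨S.filter (· ∈ P), ?_, by ext; simp⟩
    have h : ((S.filter (· ∈ P) : Finset Pt3) : Set Pt3) = ↑S ∩ P := by ext; simp
    have hc : (S.filter (· ∈ P)).card = k := by rw [← Set.ncard_coe_finset, h, hPk]
    exact Finset.mem_filter.2 ⟨mem_planeSections.2 ⟨by omega, P, hP, h⟩, hc⟩
  · rintro ⟨B, hB, rfl⟩
    obtain ⟨hB, hBk⟩ := Finset.mem_filter.1 hB
    obtain ⟨-, P, hP, h⟩ := mem_planeSections.1 hB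
    exact ⟨P, ⟨hP, by rw [← h, Set.ncard_coe_finset, hBk]⟩, h.symm⟩

/-- Melchior's inequality for the projection of `S` from one of its points `p`. -/
theorem sum_planeSections_through_le [DecidableEq Pt3] {S : Finset Pt3} (h3 : NoThreeCollinear S)
    (hpl : ¬ Coplanar ℝ (S : Set Pt3)) {p : Pt3} (hp : p ∈ S) :
    ∑ B ∈ (planeSections S).filter (p ∈ ·), (B.card - 2) + 3 ≤
      2 * ((planeSections S).filter (p ∈ ·)).card := by
  set A := S.erase p with hA
  have hAS : ∀ a ∈ A, a ≠ p ∧ a ∈ S := fun a ha => Finset.mem_erase.1 ha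
  have hcol : ∀ a ∈ A, ∀ b ∈ A, a ≠ b → ¬ Collinear ℝ {p, a, b} := fun a ha b hb hab =>
    h3.not_collinear hp (hAS a ha).2 (hAS b hb).2 (hAS a ha).1.symm (hAS b hb).1.symm hab
  obtain ⟨x, y, hx, hxy⟩ := exists_projection (Finset.notMem_erase p S) hcol
  have hself : ∀ a ∈ A, ∀ b ∈ A, a ≠ b →
      a ∈ pointsOn A x y (lineThrough x y a b) ∧ b ∈ pointsOn A x y (lineThrough x y a b) :=
    fun a ha b hb hab =>
      ⟨mem_pointsOn.2 ⟨ha, (hxy a ha b hb hab a ha).2 (subset_affineSpan ℝ _ (by simp))⟩,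
        mem_pointsOn.2 ⟨hb, (hxy a ha b hb hab b hb).2 (subset_affineSpan ℝ _ (by simp))⟩⟩
  have hsection : ∀ a ∈ A, ∀ b ∈ A, a ≠ b →
      ((insert p (pointsOn A x y (lineThrough x y a b)) : Finset Pt3) : Set Pt3) =
        ↑S ∩ (affineSpan ℝ ({p, a, b} : Set Pt3) : Set Pt3) := by
    intro a ha b hb hab
    ext c
    simp only [Finset.coe_insert, Set.mem_insert_iff, mem_pointsOn, Set.mem_inter_iff,
      SetLike.mem_coe]
    constructor
    · rintro (rfl | ⟨hc, h⟩)
      · exact ⟨hp, subset_affineSpan ℝ _ (by simp)⟩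
      · exact ⟨(hAS c hc).2, (hxy a ha b hb hab c hc).1 h⟩
    · rintro ⟨hc, h⟩
      by_cases hcp : c = p
      · exact .inl hcp
      · have hcA : c ∈ A := Finset.mem_erase.2 ⟨hcp, hc⟩
        exact .inr ⟨hcA, (hxy a ha b hb hab c hcA).2 h⟩
  have hpnot : ∀ l, p ∉ pointsOn A x y l := fun l h => (hAS p (mem_pointsOn.1 h).1).1 rfl
  have hnc : ∀ l, ∃ v ∈ A, height x y l v ≠ 0 := by
    intro l
    by_contra! hl
    by_cases h : ∃ a ∈ A, ∃ b ∈ A, a ≠ b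
    · obtain ⟨a, ha, b, hb, hab⟩ := h
      have hlab : lineThrough x y a b = l := line_eq_of_height_eq_zero
        (fun h => hab (hx ha hb h)) (mem_pointsOn.1 (hself a ha b hb hab).1).2
        (mem_pointsOn.1 (hself a ha b hb hab).2).2 (hl a ha) (hl b hb)
      have hsub : (S : Set Pt3) ⊆ affineSpan ℝ ({p, a, b} : Set Pt3) := by
        rw [← Set.inter_eq_left, ← hsection a ha b hb hab, hlab,
          show pointsOn A x y l = A from Finset.filter_true_of_mem fun v hv => by
            have := hl v hv; simp only [height] at this; linarith,
          hA, Finset.insert_erase hp]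
      have hdir := AffineSubspace.direction_le (affineSpan_le.2 hsub)
      rw [direction_affineSpan, direction_affineSpan] at hdir
      exact hpl ((Submodule.rank_mono hdir).trans (coplanar_triple ℝ p a b))
    · push Not at h
      have hsub : ∃ a, (S : Set Pt3) ⊆ {p, a, a} := by
        rcases A.eq_empty_or_nonempty with h0 | ⟨a, ha⟩
        · refine ⟨p, fun v hv => ?_⟩
          by_contra hvp
          have : v ∈ A := Finset.mem_erase.2 ⟨fun h => hvp (by simp [h]), hv⟩
          simp [h0] at this
        · refine ⟨a, fun v hv => ?_⟩
          by_cases hvp : v = p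
          · simp [hvp]
          · simp [h v (Finset.mem_erase.2 ⟨hvp, hv⟩) a ha]
      obtain ⟨a, ha⟩ := hsub
      exact hpl ((coplanar_triple ℝ p a a).subset ha)
  have hmem : ∀ l ∈ connectingLines A x y,
      insert p (pointsOn A x y l) ∈ (planeSections S).filter (p ∈ ·) := by
    intro l hl
    obtain ⟨⟨a, b⟩, hab, rfl⟩ := Finset.mem_image.1 hl
    obtain ⟨ha, hb, hab⟩ := Finset.mem_offDiag.1 hab
    refine Finset.mem_filter.2 ⟨mem_planeSections.2 ⟨?_, _, isPlane_affineSpan (hcol a ha b hb hab),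
      hsection a ha b hb hab⟩, Finset.mem_insert_self _ _⟩
    rw [Finset.card_insert_of_notMem (hpnot _)]
    have : 1 < (pointsOn A x y (lineThrough x y a b)).card :=
      Finset.one_lt_card.2 ⟨a, (hself a ha b hb hab).1, b, (hself a ha b hb hab).2, hab⟩
    exact Nat.succ_le_succ this
  have hinj : InjOn (fun l => insert p (pointsOn A x y l)) (connectingLines A x y) := by
    intro l hl l' hl' h
    have h' : pointsOn A x y l = pointsOn A x y l' := by
      rw [← Finset.erase_insert (hpnot l), ← Finset.erase_insert (hpnot l')]
      exact congrArg (Finset.erase · p) h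
    obtain ⟨⟨a, b⟩, hab, rfl⟩ := Finset.mem_image.1 hl
    obtain ⟨ha, hb, hab⟩ := Finset.mem_offDiag.1 hab
    obtain ⟨h1, h2⟩ := hself a ha b hb hab
    refine line_eq_of_height_eq_zero (fun h => hab (hx ha hb h)) (mem_pointsOn.1 h1).2
      (mem_pointsOn.1 h2).2 (mem_pointsOn.1 (h' ▸ h1)).2 (mem_pointsOn.1 (h' ▸ h2)).2
  have himage : (connectingLines A x y).image (fun l => insert p (pointsOn A x y l)) =
      (planeSections S).filter (p ∈ ·) := by
    refine Finset.Subset.antisymm (Finset.image_subset_iff.2 hmem) fun B hB => ?_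
    obtain ⟨hB, hpB⟩ := Finset.mem_filter.1 hB
    obtain ⟨hB3, P, hP, hBP⟩ := mem_planeSections.1 hB
    obtain ⟨a, ha, b, hb, hab⟩ : ∃ a ∈ B.erase p, ∃ b ∈ B.erase p, a ≠ b := by
      rw [← Finset.one_lt_card, Finset.card_erase_of_mem hpB]
      omega
    have hBmem : ∀ v ∈ B, v ∈ (S : Set Pt3) ∩ P := fun v hv => hBP ▸ Finset.mem_coe.2 hv
    have hBA : ∀ v ∈ B.erase p, v ∈ A ∧ v ∈ P := fun v hv =>
      ⟨Finset.mem_erase.2 ⟨(Finset.mem_erase.1 hv).1, (hBmem v (Finset.mem_erase.1 hv).2).1⟩,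
        (hBmem v (Finset.mem_erase.1 hv).2).2⟩
    obtain ⟨haA, haP⟩ := hBA a ha
    obtain ⟨hbA, hbP⟩ := hBA b hb
    refine Finset.mem_image.2 ⟨lineThrough x y a b, lineThrough_mem_connectingLines haA hbA hab,
      Finset.coe_injective ?_⟩
    rw [hsection a haA b hbA hab, hBP,
      hP.eq_affineSpan (hBmem p hpB).2 haP hbP (hcol a haA b hbA hab)]
  have hM := melchior hx hnc
  rw [← himage, Finset.sum_image hinj, Finset.card_image_of_injOn hinj]
  refine le_trans (le_of_eq ?_) hM
  congr 1
  refine Finset.sum_congr rfl fun l _ => ?_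
  rw [Finset.card_insert_of_notMem (hpnot l)]
  rfl

theorem three_mul_card_le_sum {S : Finset Pt3} (h3 : NoThreeCollinear S)
    (hpl : ¬ Coplanar ℝ (S : Set Pt3)) :
    3 * (S.card : ℝ) ≤ ∑ B ∈ planeSections S, (B.card : ℝ) * (4 - B.card) := by
  classical
  have hlocal : ∀ p ∈ S, (3 : ℝ) ≤ ∑ B ∈ (planeSections S).filter (p ∈ ·), (4 - (B.card : ℝ)) := by
    intro p hp
    have h := sum_planeSections_through_le h3 hpl hp
    have h' : (∑ B ∈ (planeSections S).filter (p ∈ ·), (((B.card - 2 : ℕ)) : ℝ)) + 3 ≤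
        2 * ((planeSections S).filter (p ∈ ·)).card := by exact_mod_cast h
    have h2 : ∑ B ∈ (planeSections S).filter (p ∈ ·), (((B.card - 2 : ℕ)) : ℝ) =
        ∑ B ∈ (planeSections S).filter (p ∈ ·), ((B.card : ℝ) - 2) := by
      refine Finset.sum_congr rfl fun B hB => ?_
      have := (mem_planeSections.1 (Finset.mem_filter.1 hB).1).1
      push_cast [Nat.cast_sub (show 2 ≤ B.card by omega)]
      ring
    rw [h2] at h'
    simp only [Finset.sum_sub_distrib, Finset.sum_const, nsmul_eq_mul] at h' ⊢
    linarith
  calc 3 * (S.card : ℝ) = ∑ p ∈ S, 3 := by simp [mul_comm]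
    _ ≤ ∑ p ∈ S, ∑ B ∈ (planeSections S).filter (p ∈ ·), (4 - (B.card : ℝ)) :=
        Finset.sum_le_sum hlocal
    _ = ∑ B ∈ planeSections S, ∑ p ∈ B, (4 - (B.card : ℝ)) := by
        refine Finset.sum_comm' fun p B => ?_
        simp only [Finset.mem_filter]
        constructor
        · exact fun h => ⟨h.2.2, h.2.1⟩
        · rintro ⟨hpB, hB⟩
          obtain ⟨-, P, -, h⟩ := mem_planeSections.1 hB
          have : p ∈ (S : Set Pt3) ∩ P := h ▸ Finset.mem_coe.2 hpB
          exact ⟨this.1, hB, hpB⟩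
    _ = ∑ B ∈ planeSections S, (B.card : ℝ) * (4 - B.card) := by
        simp only [Finset.sum_const, nsmul_eq_mul]

theorem stmt7 (S : Set Pt3) (hS : S.Finite) (n : ℕ) (hn : S.ncard = n)
    (h3 : NoThreeCollinear S) (hpl : ¬ Coplanar ℝ S) :
    ((planeCount S 3 : ℝ) ≥
        (n : ℝ) + (1 / 3) * ∑ k ∈ Finset.Icc 4 n, (k : ℝ) * ((k : ℝ) - 4) * planeCount S k) ∧
      n ≤ planeCount S 3 := by
  lift S to Finset Pt3 using hS
  rw [Set.ncard_coe_finset] at hn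
  have hsum := three_mul_card_le_sum h3 hpl
  have hfiber : ∑ B ∈ planeSections S, (B.card : ℝ) * (4 - B.card) =
      ∑ k ∈ Finset.Icc 3 n, (k : ℝ) * (4 - k) * planeCount S k := by
    rw [← Finset.sum_fiberwise_of_maps_to (s := planeSections S) (t := Finset.Icc 3 n)
      (g := Finset.card)]
    · refine Finset.sum_congr rfl fun k hk => ?_
      rw [planeCount_eq_card h3 (Finset.mem_Icc.1 hk).1, Finset.sum_congr rfl
        (g := fun _ => (k : ℝ) * (4 - k)) fun B hB => by rw [(Finset.mem_filter.1 hB).2]]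
      rw [Finset.sum_const, nsmul_eq_mul, mul_comm]
    · intro B hB
      obtain ⟨hB3, P, -, h⟩ := mem_planeSections.1 hB
      have hBS : B ⊆ S := Finset.coe_subset.1 (h ▸ Set.inter_subset_left)
      exact Finset.mem_Icc.2 ⟨hB3, hn ▸ Finset.card_le_card hBS⟩
  have hn3 : 3 ≤ n := by
    by_contra! hlt
    rw [hfiber, Finset.Icc_eq_empty (by omega), Finset.sum_empty, hn] at hsum
    have hn0 : n = 0 := by
      have : (n : ℝ) ≤ 0 := by linarith
      exact_mod_cast this.antisymm n.cast_nonneg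
    rw [hn0, Finset.card_eq_zero] at hn
    exact hpl (by simp [hn, coplanar_empty])
  rw [hfiber, ← Finset.insert_Icc_add_one_left_eq_Icc hn3, Finset.sum_insert (by simp), hn] at hsum
  have hneg : ∑ k ∈ Finset.Icc (3 + 1) n, (k : ℝ) * (4 - k) * planeCount S k =
      -∑ k ∈ Finset.Icc 4 n, (k : ℝ) * (k - 4) * planeCount S k := by
    rw [← Finset.sum_neg_distrib]
    exact Finset.sum_congr rfl fun k _ => by ring
  have hnonneg : 0 ≤ ∑ k ∈ Finset.Icc 4 n, (k : ℝ) * ((k : ℝ) - 4) * planeCount S k := by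
    refine Finset.sum_nonneg fun k hk => ?_
    have : (4 : ℝ) ≤ k := by exact_mod_cast (Finset.mem_Icc.1 hk).1
    have : 0 ≤ (k : ℝ) - 4 := by linarith
    positivity
  rw [hneg] at hsum
  push_cast at hsum
  have hmain : (planeCount S 3 : ℝ) ≥
      (n : ℝ) + (1 / 3) * ∑ k ∈ Finset.Icc 4 n, (k : ℝ) * ((k : ℝ) - 4) * planeCount S k := by
    linarith
  refine ⟨hmain, ?_⟩
  have : (n : ℝ) ≤ planeCount S 3 := by linarith
  exact_mod_cast this
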